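/- Let G=(V,w,m,d₀) be a salami with the combinatorial distance d₀, let P be a connected salami partition, and let f ∈ ℋ(P). Then for all real numbers a, b with b - a ≥ 2, the level set f⁻¹([a,b)) = {x ∈ V : a ≤ f(x) < b} is connected as an induced subgraph of G. -/

import Mathlib

open Filter

namespace SalamiPaper

variable {V : Type*}

/-- Locally finite: every vertex has finitely many neighbors. -/
def LocallyFinite (w : V → V → ℝ) : Prop := ∀ x : V, {y | 0 < w x y}.Finite

/-- Connectedness of the weighted graph: any two vertices are joined by a path. -/
def GraphConnected (w : V → V → ℝ) : Prop :=
  ∀ x y : V, Relation.ReflTransGen (fun a b => 0 < w a b) x y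

/-- The weighted graph Laplacian `Δf(x) = (1/m(x)) ∑_y w(x,y)(f(y)-f(x))`. -/
noncomputable def lap (w : V → V → ℝ) (m : V → ℝ) (f : V → ℝ) (x : V) : ℝ :=
  (m x)⁻¹ * ∑ᶠ y, w x y * (f y - f x)

/-- The vertex degree `Deg(x) = (1/m(x)) ∑_y w(x,y)`. -/
noncomputable def deg (w : V → V → ℝ) (m : V → ℝ) (x : V) : ℝ :=
  (m x)⁻¹ * ∑ᶠ y, w x y

/-- The set of `d`-lengths of adjacency paths from `x` to `y`. -/
def pathLens (w : V → V → ℝ) (d : V → V → ℝ) (x y : V) : Set ℝ :=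
  {L | ∃ (n : ℕ) (p : ℕ → V), p 0 = x ∧ p n = y ∧
    (∀ i < n, 0 < w (p i) (p (i + 1))) ∧
    L = ∑ i ∈ Finset.range n, d (p i) (p (i + 1))}

/-- `d` is a path metric on the graph with edge weight `w`. -/
def IsPathMetric (w : V → V → ℝ) (d : V → V → ℝ) : Prop :=
  (∀ x, d x x = 0) ∧ (∀ x y, x ≠ y → 0 < d x y) ∧ (∀ x y, d x y = d y x) ∧
  (∀ x y z, d x z ≤ d x y + d y z) ∧
  (∀ x y, d x y = sInf (pathLens w d x y))

/-- All balls are finite. -/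
def FiniteBalls (d : V → V → ℝ) : Prop := ∀ (x : V) (R : ℝ), {y | d x y ≤ R}.Finite

/-- The combinatorial graph distance (as a real number). -/
noncomputable def combDist (w : V → V → ℝ) (x y : V) : ℝ :=
  sInf {L | ∃ (n : ℕ) (p : ℕ → V), p 0 = x ∧ p n = y ∧
    (∀ i < n, 0 < w (p i) (p (i + 1))) ∧ L = (n : ℝ)}

/-- `Lip(1)`: the 1-Lipschitz functions with respect to `d`. -/
def Lip1 (d : V → V → ℝ) (f : V → ℝ) : Prop := ∀ x y, f y - f x ≤ d x y

/-- The Ollivier curvature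
`κ(x,y) = (1/d(x,y)) inf{Δf(x) - Δf(y) : f ∈ Lip(1), f(y)-f(x) = d(x,y)}`. -/
noncomputable def kappa (w : V → V → ℝ) (m : V → ℝ) (d : V → V → ℝ) (x y : V) : ℝ :=
  (d x y)⁻¹ * sInf {c | ∃ f : V → ℝ, Lip1 d f ∧ f y - f x = d x y ∧
    c = lap w m f x - lap w m f y}

/-- `m(A) = ∞`: the total measure of `A` is infinite. -/
def InfVolume (m : V → ℝ) (A : Set V) : Prop :=
  ∀ c : ℝ, ∃ F : Finset V, ↑F ⊆ A ∧ c < ∑ x ∈ F, m x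

/-- A salami partition `(X,Y,K)`. -/
def SalamiPartition (w : V → V → ℝ) (m : V → ℝ) (X Y K : Set V) : Prop :=
  X ∪ Y ∪ K = Set.univ ∧ Disjoint X Y ∧ Disjoint X K ∧ Disjoint Y K ∧
  K.Finite ∧ (∀ x ∈ X, ∀ y ∈ Y, w x y = 0) ∧ InfVolume m X ∧ InfVolume m Y

/-- Reachability inside a subset `A` of the vertex set. -/
def reachIn (w : V → V → ℝ) (A : Set V) : V → V → Prop :=
  Relation.ReflTransGen (fun a b => a ∈ A ∧ b ∈ A ∧ 0 < w a b)

/-- The induced subgraph on `A` is connected. -/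
def ConnectedIn (w : V → V → ℝ) (A : Set V) : Prop :=
  ∀ x ∈ A, ∀ y ∈ A, reachIn w A x y

/-- A connected salami partition: `K` induces a connected subgraph. -/
def ConnectedSalamiPartition (w : V → V → ℝ) (m : V → ℝ) (X Y K : Set V) : Prop :=
  SalamiPartition w m X Y K ∧ ConnectedIn w K

/-- The basic standing assumptions on a weighted graph `G = (V,w,m,d)`:
countable vertex set, symmetric non-negative edge weight vanishing on the diagonal,
positive vertex measure, local finiteness, connectedness,
`d` a path metric with finite balls. -/
def IsGraphBase (w : V → V → ℝ) (m : V → ℝ) (d : V → V → ℝ) : Prop :=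
  Countable V ∧ (∀ x y, w x y = w y x) ∧ (∀ x y, 0 ≤ w x y) ∧ (∀ x, w x x = 0) ∧
  (∀ x, 0 < m x) ∧ LocallyFinite w ∧ GraphConnected w ∧
  IsPathMetric w d ∧ FiniteBalls d

/-- Non-negative Ollivier curvature on all edges. -/
def NonnegCurv (w : V → V → ℝ) (m : V → ℝ) (d : V → V → ℝ) : Prop :=
  ∀ x y, 0 < w x y → 0 ≤ kappa w m d x y

/-- A salami: a connected, locally finite weighted graph with a path metric with
finite balls, non-negative Ollivier curvature, admitting a salami partition. -/
def IsSalami (w : V → V → ℝ) (m : V → ℝ) (d : V → V → ℝ) : Prop :=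
  IsGraphBase w m d ∧ NonnegCurv w m d ∧ ∃ X Y K : Set V, SalamiPartition w m X Y K

/-- `G` has at least `n` ends: there is a finite set `K` such that `V ∖ K` has at
least `n` infinite connected components. -/
def atLeastEnds (w : V → V → ℝ) (n : ℕ) : Prop :=
  ∃ K : Set V, K.Finite ∧ ∃ x : Fin n → V,
    (∀ i, x i ∉ K) ∧ (∀ i, {y | reachIn w Kᶜ (x i) y}.Infinite) ∧
    (∀ i j, i ≠ j → ¬ reachIn w Kᶜ (x i) (x j))

/-- `Lip(1,K)`: functions that are 1-Lipschitz on `K`. -/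
def Lip1On (d : V → V → ℝ) (K : Set V) (f : V → ℝ) : Prop :=
  ∀ x ∈ K, ∀ y ∈ K, f y - f x ≤ d x y

open Classical in
/-- The extremal Lipschitz extension operator `S(P)` of the salami partition
`P = (X,Y,K)`. -/
noncomputable def Sop (d : V → V → ℝ) (X Y K : Set V) (f : V → ℝ) : V → ℝ :=
  fun v =>
    if v ∈ K then f v
    else if v ∈ X then sSup {c | ∃ u ∈ K, c = f u - d v u}
    else sInf {c | ∃ u ∈ K, c = f u + d v u}

/-- `ℱ(P) = S(P)(Lip(1,K))`. -/
def calF (d : V → V → ℝ) (X Y K : Set V) : Set (V → ℝ) :=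
  {g | ∃ f : V → ℝ, Lip1On d K f ∧ g = Sop d X Y K f}

/-- `ℋ(P)`: the harmonic functions in `ℱ(P)`. -/
def calH (w : V → V → ℝ) (m : V → ℝ) (d : V → V → ℝ) (X Y K : Set V) :
    Set (V → ℝ) :=
  {g | g ∈ calF d X Y K ∧ ∀ x, lap w m g x = 0}

/-- `∇₊f(x) = max_{y∼x} (f(y)-f(x))/d(x,y)`. -/
noncomputable def gradPlus (w : V → V → ℝ) (d : V → V → ℝ) (f : V → ℝ) (x : V) : ℝ :=
  sSup {c | ∃ y, 0 < w x y ∧ c = (f y - f x) / d x y}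

/-- `∇₋f(x) = max_{y∼x} (f(x)-f(y))/d(x,y)`. -/
noncomputable def gradMinus (w : V → V → ℝ) (d : V → V → ℝ) (f : V → ℝ) (x : V) : ℝ :=
  sSup {c | ∃ y, 0 < w x y ∧ c = (f x - f y) / d x y}

/-- `|∇f|(x) = max_{y∼x} |f(y)-f(x)|/d(x,y)`. -/
noncomputable def gradAbs (w : V → V → ℝ) (d : V → V → ℝ) (f : V → ℝ) (x : V) : ℝ :=
  sSup {c | ∃ y, 0 < w x y ∧ c = |f y - f x| / d x y}

/-- Recurrence: for every `ε > 0` there is a finitely supported `f` with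
`‖f‖∞ = 1` and `-⟨f, Δf⟩ < ε`. -/
def Recurrent (w : V → V → ℝ) (m : V → ℝ) : Prop :=
  ∀ ε : ℝ, 0 < ε → ∃ f : V → ℝ, (Function.support f).Finite ∧
    (∀ x, |f x| ≤ 1) ∧ (∃ x, |f x| = 1) ∧
    -(∑ᶠ x, f x * lap w m f x * m x) < ε

open Classical in
/-- `∑_{x,y : f(y) < 0 ≤ f(x)} w(x,y)(f(x)-f(y))`. -/
noncomputable def cutSum (w : V → V → ℝ) (f : V → ℝ) : ℝ :=
  ∑ᶠ p : V × V, if f p.2 < 0 ∧ 0 ≤ f p.1 then w p.1 p.2 * (f p.1 - f p.2) else 0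

/-- Subexponential growth: `max_{B_r(x)} |u| = e^{o(r)}` as `r → ∞`. -/
def SubexpGrowth (d : V → V → ℝ) (x : V) (u : V → ℝ) : Prop :=
  Filter.Tendsto
    (fun r : ℕ => Real.log (sSup {c | ∃ y, d x y ≤ (r : ℝ) ∧ c = |u y|}) / (r : ℝ))
    Filter.atTop (nhds 0)


section GraphDistance

variable {w : V → V → ℝ} {m : V → ℝ}

theorem combDist_le_of_path {x y : V} (n : ℕ) (p : ℕ → V) (h0 : p 0 = x) (hn : p n = y)
    (hp : ∀ i < n, 0 < w (p i) (p (i + 1))) : combDist w x y ≤ n := by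
  apply csInf_le
  · refine ⟨0, ?_⟩
    rintro L ⟨k, -, -, -, -, rfl⟩
    positivity
  · exact ⟨n, p, h0, hn, hp, rfl⟩

theorem exists_path (hc : GraphConnected w) (x y : V) :
    ∃ (n : ℕ) (p : ℕ → V), p 0 = x ∧ p n = y ∧ ∀ i < n, 0 < w (p i) (p (i + 1)) := by
  induction hc x y using Relation.ReflTransGen.head_induction_on with
  | refl => exact ⟨0, fun _ => y, rfl, rfl, by simp⟩
  | @head a c hab _ ih =>
    obtain ⟨n, p, h0, hn, hp⟩ := ih
    refine ⟨n + 1, fun i => Nat.casesOn i a p, rfl, hn, ?_⟩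
    intro i hi
    cases i with
    | zero => simpa [h0] using hab
    | succ i => exact hp i (by omega)

theorem exists_shortest_path (hc : GraphConnected w) (x y : V) :
    ∃ (n : ℕ) (p : ℕ → V), p 0 = x ∧ p n = y ∧ (∀ i < n, 0 < w (p i) (p (i + 1))) ∧
      combDist w x y = n := by
  classical
  have hex := exists_path hc x y
  obtain ⟨p, h0, hn, hp⟩ := Nat.find_spec hex
  refine ⟨Nat.find hex, p, h0, hn, hp, le_antisymm (combDist_le_of_path _ p h0 hn hp) ?_⟩
  apply le_csInf
  · exact ⟨_, _, p, h0, hn, hp, rfl⟩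
  · rintro L ⟨k, q, hq0, hqk, hq, rfl⟩
    exact_mod_cast Nat.find_min' hex ⟨q, hq0, hqk, hq⟩

namespace IsGraphBase

theorem dist_self (hG : IsGraphBase w m (combDist w)) (x : V) : combDist w x x = 0 :=
  hG.2.2.2.2.2.2.2.1.1 x

theorem dist_pos (hG : IsGraphBase w m (combDist w)) {x y : V} (h : x ≠ y) :
    0 < combDist w x y :=
  hG.2.2.2.2.2.2.2.1.2.1 x y h

theorem dist_comm (hG : IsGraphBase w m (combDist w)) (x y : V) :
    combDist w x y = combDist w y x :=
  hG.2.2.2.2.2.2.2.1.2.2.1 x y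

theorem dist_triangle (hG : IsGraphBase w m (combDist w)) (x y z : V) :
    combDist w x z ≤ combDist w x y + combDist w y z :=
  hG.2.2.2.2.2.2.2.1.2.2.2.1 x y z

theorem finite_ball (hG : IsGraphBase w m (combDist w)) (x : V) (R : ℝ) :
    {y | combDist w x y ≤ R}.Finite :=
  hG.2.2.2.2.2.2.2.2 x R

theorem connected (hG : IsGraphBase w m (combDist w)) : GraphConnected w :=
  hG.2.2.2.2.2.2.1

theorem locallyFinite (hG : IsGraphBase w m (combDist w)) : LocallyFinite w :=
  hG.2.2.2.2.2.1

theorem measure_pos (hG : IsGraphBase w m (combDist w)) (x : V) : 0 < m x :=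
  hG.2.2.2.2.1 x

theorem weight_self (hG : IsGraphBase w m (combDist w)) (x : V) : w x x = 0 :=
  hG.2.2.2.1 x

theorem weight_nonneg (hG : IsGraphBase w m (combDist w)) (x y : V) : 0 ≤ w x y :=
  hG.2.2.1 x y

theorem weight_comm (hG : IsGraphBase w m (combDist w)) (x y : V) : w x y = w y x :=
  hG.2.1 x y

theorem dist_nonneg (hG : IsGraphBase w m (combDist w)) (x y : V) : 0 ≤ combDist w x y := by
  rcases eq_or_ne x y with rfl | h
  · exact (hG.dist_self x).ge
  · exact (hG.dist_pos h).le

theorem exists_dist_eq_nat (hG : IsGraphBase w m (combDist w)) (x y : V) :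
    ∃ n : ℕ, combDist w x y = n :=
  let ⟨n, _, _, _, _, h⟩ := exists_shortest_path hG.connected x y
  ⟨n, h⟩

theorem ne_of_adj (hG : IsGraphBase w m (combDist w)) {x y : V} (h : 0 < w x y) : x ≠ y := by
  rintro rfl
  exact h.ne' (hG.weight_self x)

theorem dist_eq_one (hG : IsGraphBase w m (combDist w)) {x y : V} (h : 0 < w x y) :
    combDist w x y = 1 := by
  obtain ⟨n, hn⟩ := hG.exists_dist_eq_nat x y
  have hpos := hG.dist_pos (hG.ne_of_adj h)
  have hle : combDist w x y ≤ (1 : ℕ) :=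
    combDist_le_of_path 1 (fun i => if i = 0 then x else y) (by simp) (by simp) (by
      intro i hi
      obtain rfl : i = 0 := by omega
      simpa using h)
  rw [hn] at hpos hle ⊢
  have h1 : 0 < n := by exact_mod_cast hpos
  have h2 : n ≤ 1 := by exact_mod_cast hle
  obtain rfl : n = 1 := by omega
  simp

/-- The first step of a geodesic. -/
theorem exists_step (hG : IsGraphBase w m (combDist w)) {x y : V} (h : x ≠ y) :
    ∃ z, 0 < w x z ∧ combDist w z y = combDist w x y - 1 := by
  obtain ⟨n, p, h0, hn, hp, hd⟩ := exists_shortest_path hG.connected x y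
  have hpos := hG.dist_pos h
  rw [hd] at hpos
  have h1 : 0 < n := by exact_mod_cast hpos
  obtain ⟨k, rfl⟩ : ∃ k, n = k + 1 := ⟨n - 1, by omega⟩
  have hadj : 0 < w x (p 1) := by simpa [h0] using hp 0 h1
  refine ⟨p 1, hadj, ?_⟩
  have hle : combDist w (p 1) y ≤ k :=
    combDist_le_of_path k (fun i => p (i + 1)) rfl hn (fun i hi => hp (i + 1) (by omega))
  have htri := hG.dist_triangle x (p 1) y
  rw [hG.dist_eq_one hadj] at htri
  push_cast at hd
  linarith

/-- A geodesic leaving `Y` meets the set `A` separating `Y` from the rest. -/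
theorem exists_between (hG : IsGraphBase w m (combDist w)) {A Y : Set V}
    (hsep : ∀ y ∈ Y, ∀ z, z ∉ Y → z ∉ A → ¬ 0 < w y z) {x y : V} (hx : x ∉ Y) (hy : y ∈ Y) :
    ∃ u ∈ A, combDist w y x = combDist w y u + combDist w u x := by
  obtain ⟨n, hn⟩ := hG.exists_dist_eq_nat y x
  induction n generalizing y with
  | zero =>
    have hne : y ≠ x := fun h => hx (h ▸ hy)
    have := hG.dist_pos hne
    simp [hn] at this
  | succ n ih =>
    have hne : y ≠ x := fun h => hx (h ▸ hy)
    obtain ⟨z, hz, hd⟩ := hG.exists_step hne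
    have h1 := hG.dist_eq_one hz
    by_cases hzA : z ∈ A
    · exact ⟨z, hzA, by linarith⟩
    by_cases hzY : z ∈ Y
    · obtain ⟨u, hu, hdu⟩ := ih hzY (by rw [hd, hn]; push_cast; ring)
      have t1 := hG.dist_triangle y z u
      have t2 := hG.dist_triangle y u x
      exact ⟨u, hu, by linarith⟩
    · exact absurd hz (hsep y hy z hzY hzA)

end IsGraphBase

end GraphDistance

section Laplacian

variable {w : V → V → ℝ} {m : V → ℝ}

/-- The finite set of neighbors of `x`. -/
noncomputable def nbrs (hG : IsGraphBase w m (combDist w)) (x : V) : Finset V :=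
  (hG.locallyFinite x).toFinset

theorem mem_nbrs (hG : IsGraphBase w m (combDist w)) {x y : V} :
    y ∈ nbrs hG x ↔ 0 < w x y := by
  simp [nbrs]

theorem finsum_weight_mul (hG : IsGraphBase w m (combDist w)) {x : V} {N : Finset V}
    (hN : nbrs hG x ⊆ N) (h : V → ℝ) : ∑ᶠ y, w x y * h y = ∑ y ∈ N, w x y * h y := by
  apply finsum_eq_sum_of_support_subset
  intro y hy
  apply hN
  rw [mem_nbrs]
  exact (hG.weight_nonneg x y).lt_of_ne' (left_ne_zero_of_mul hy)

theorem lap_eq_sum (hG : IsGraphBase w m (combDist w)) (f : V → ℝ) (x : V) :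
    lap w m f x = (m x)⁻¹ * ∑ y ∈ nbrs hG x, w x y * (f y - f x) := by
  rw [lap, finsum_weight_mul hG subset_rfl]

theorem deg_eq_sum (hG : IsGraphBase w m (combDist w)) (x : V) :
    deg w m x = (m x)⁻¹ * ∑ y ∈ nbrs hG x, w x y := by
  have := finsum_weight_mul hG (x := x) subset_rfl (fun _ => 1)
  simp only [mul_one] at this
  rw [deg, this]

theorem deg_nonneg (hG : IsGraphBase w m (combDist w)) (x : V) : 0 ≤ deg w m x := by
  rw [deg_eq_sum hG]
  exact mul_nonneg (inv_nonneg.2 (hG.measure_pos x).le)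
    (Finset.sum_nonneg fun y _ => hG.weight_nonneg x y)

theorem lap_sub (hG : IsGraphBase w m (combDist w)) (f g : V → ℝ) (x : V) :
    lap w m (fun z => f z - g z) x = lap w m f x - lap w m g x := by
  simp only [lap_eq_sum hG]
  rw [← mul_sub, ← Finset.sum_sub_distrib]
  congr 1
  exact Finset.sum_congr rfl fun y _ => by ring

theorem lap_neg (hG : IsGraphBase w m (combDist w)) (f : V → ℝ) (x : V) :
    lap w m (fun z => -f z) x = -lap w m f x := by
  simp only [lap_eq_sum hG]
  rw [← mul_neg, ← Finset.sum_neg_distrib]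
  congr 1
  exact Finset.sum_congr rfl fun y _ => by ring

theorem lap_le_deg_mul (hG : IsGraphBase w m (combDist w)) {h : V → ℝ} {x : V} {c : ℝ}
    (hc : ∀ z, 0 < w x z → h z - h x ≤ c) : lap w m h x ≤ deg w m x * c := by
  rw [lap_eq_sum hG, deg_eq_sum hG, mul_assoc, Finset.sum_mul]
  refine mul_le_mul_of_nonneg_left ?_ (inv_nonneg.2 (hG.measure_pos x).le)
  exact Finset.sum_le_sum fun y hy =>
    mul_le_mul_of_nonneg_left (hc y ((mem_nbrs hG).1 hy)) (hG.weight_nonneg x y)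

theorem lap_pos (hG : IsGraphBase w m (combDist w)) {h : V → ℝ} {x y : V}
    (hle : ∀ z, 0 < w x z → h x ≤ h z) (hxy : 0 < w x y) (hlt : h x < h y) :
    0 < lap w m h x := by
  rw [lap_eq_sum hG]
  refine mul_pos (inv_pos.2 (hG.measure_pos x)) ?_
  exact Finset.sum_pos' (fun z hz => mul_nonneg (hG.weight_nonneg x z)
    (sub_nonneg.2 (hle z ((mem_nbrs hG).1 hz))))
    ⟨y, (mem_nbrs hG).2 hxy, mul_pos hxy (sub_pos.2 hlt)⟩

theorem lap_nonneg (hG : IsGraphBase w m (combDist w)) {h : V → ℝ} {x : V}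
    (hle : ∀ z, 0 < w x z → h x ≤ h z) : 0 ≤ lap w m h x := by
  rw [lap_eq_sum hG]
  exact mul_nonneg (inv_nonneg.2 (hG.measure_pos x).le)
    (Finset.sum_nonneg fun z hz => mul_nonneg (hG.weight_nonneg x z)
      (sub_nonneg.2 (hle z ((mem_nbrs hG).1 hz))))

theorem add_mul_lap_eq (hG : IsGraphBase w m (combDist w)) (h : V → ℝ) (x : V) (ε : ℝ) :
    h x + ε * lap w m h x =
      (1 - ε * deg w m x) * h x + ε * ((m x)⁻¹ * ∑ y ∈ nbrs hG x, w x y * h y) := by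
  rw [lap_eq_sum hG, deg_eq_sum hG]
  simp only [mul_sub, Finset.sum_sub_distrib, ← Finset.sum_mul]
  ring

theorem add_mul_lap_nonneg (hG : IsGraphBase w m (combDist w)) {h : V → ℝ} (hh : ∀ z, 0 ≤ h z)
    {x : V} {ε : ℝ} (hε : 0 < ε) (hd : ε * deg w m x < 1) : 0 ≤ h x + ε * lap w m h x := by
  rw [add_mul_lap_eq hG]
  have := hG.measure_pos x
  have hs : 0 ≤ ∑ y ∈ nbrs hG x, w x y * h y :=
    Finset.sum_nonneg fun y _ => mul_nonneg (hG.weight_nonneg x y) (hh y)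
  have := mul_nonneg (sub_nonneg.2 hd.le) (hh x)
  positivity

theorem add_mul_lap_pos_of_self (hG : IsGraphBase w m (combDist w)) {h : V → ℝ}
    (hh : ∀ z, 0 ≤ h z) {x : V} {ε : ℝ} (hε : 0 < ε) (hd : ε * deg w m x < 1) (hx : 0 < h x) :
    0 < h x + ε * lap w m h x := by
  rw [add_mul_lap_eq hG]
  have := hG.measure_pos x
  have hs : 0 ≤ ∑ y ∈ nbrs hG x, w x y * h y :=
    Finset.sum_nonneg fun y _ => mul_nonneg (hG.weight_nonneg x y) (hh y)
  have := mul_pos (sub_pos.2 hd) hx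
  positivity

theorem add_mul_lap_pos_of_adj (hG : IsGraphBase w m (combDist w)) {h : V → ℝ}
    (hh : ∀ z, 0 ≤ h z) {x y : V} {ε : ℝ} (hε : 0 < ε) (hd : ε * deg w m x < 1)
    (hxy : 0 < w x y) (hy : 0 < h y) : 0 < h x + ε * lap w m h x := by
  rw [add_mul_lap_eq hG]
  have := hG.measure_pos x
  have hs : 0 < ∑ y ∈ nbrs hG x, w x y * h y :=
    Finset.sum_pos' (fun y _ => mul_nonneg (hG.weight_nonneg x y) (hh y))
      ⟨y, (mem_nbrs hG).2 hxy, mul_pos hxy hy⟩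
  have := mul_nonneg (sub_nonneg.2 hd.le) (hh x)
  positivity

end Laplacian

section Curvature

variable {w : V → V → ℝ} {m : V → ℝ}

theorem Lip1.neg (hG : IsGraphBase w m (combDist w)) {f : V → ℝ} (hf : Lip1 (combDist w) f) :
    Lip1 (combDist w) (fun z => -f z) := by
  intro x y
  have := hf y x
  rw [hG.dist_comm y x] at this
  linarith

theorem Lip1.le_add_one (hG : IsGraphBase w m (combDist w)) {f : V → ℝ}
    (hf : Lip1 (combDist w) f) {x y : V} (h : 0 < w x y) : f y ≤ f x + 1 := by
  have := hf x y
  rw [hG.dist_eq_one h] at this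
  linarith

theorem Lip1.sup {f g : V → ℝ} (hf : Lip1 (combDist w) f) (hg : Lip1 (combDist w) g) :
    Lip1 (combDist w) (fun z => max (f z) (g z)) := by
  intro x y
  have h1 := hf x y
  have h2 := hg x y
  have h3 := le_max_left (f x) (g x)
  have h4 := le_max_right (f x) (g x)
  rw [sub_le_iff_le_add]
  exact max_le (by linarith) (by linarith)

theorem Lip1.inf {f g : V → ℝ} (hf : Lip1 (combDist w) f) (hg : Lip1 (combDist w) g) :
    Lip1 (combDist w) (fun z => min (f z) (g z)) := by
  intro x y
  have h1 := hf x y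
  have h2 := hg x y
  have h3 : min (f y) (g y) - combDist w x y ≤ min (f x) (g x) :=
    le_min (by linarith [min_le_left (f y) (g y)]) (by linarith [min_le_right (f y) (g y)])
  linarith

theorem lip1_const_add_dist (hG : IsGraphBase w m (combDist w)) (c : ℝ) (u : V) :
    Lip1 (combDist w) (fun z => c + combDist w u z) := by
  intro x y
  have := hG.dist_triangle u x y
  linarith

theorem lip1_const_sub_dist (hG : IsGraphBase w m (combDist w)) (c : ℝ) (u : V) :
    Lip1 (combDist w) (fun z => c - combDist w u z) := by
  intro x y
  have := hG.dist_triangle u y x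
  rw [hG.dist_comm y x] at this
  linarith

theorem lap_le_lap_of_adj (hG : IsGraphBase w m (combDist w)) (hN : NonnegCurv w m (combDist w))
    {g : V → ℝ} (hg : Lip1 (combDist w) g) {x y : V} (hxy : 0 < w x y) (h1 : g y - g x = 1) :
    lap w m g y ≤ lap w m g x := by
  have hd := hG.dist_eq_one hxy
  have hk := hN x y hxy
  rw [kappa, hd, inv_one, one_mul] at hk
  have hbdd : BddBelow {c | ∃ f : V → ℝ, Lip1 (combDist w) f ∧ f y - f x = 1 ∧
      c = lap w m f x - lap w m f y} := by
    refine ⟨-(deg w m x * 1) - deg w m y * 1, ?_⟩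
    rintro c ⟨f, hf, -, rfl⟩
    have hx := lap_le_deg_mul hG (h := fun z => -f z) (x := x) (c := 1) (fun z hz => by
      linarith [(hf.neg hG).le_add_one hG hz])
    have hy := lap_le_deg_mul hG (h := f) (x := y) (c := 1) (fun z hz => by
      linarith [hf.le_add_one hG hz])
    rw [lap_neg hG] at hx
    linarith
  have := csInf_le hbdd ⟨g, hg, h1, rfl⟩
  linarith

theorem lap_sub_le_of_adj (hG : IsGraphBase w m (combDist w))
    (hN : NonnegCurv w m (combDist w)) {x y : V} (hxy : 0 < w x y) {g : V → ℝ}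
    (hg : Lip1 (combDist w) g) :
    lap w m g y - lap w m g x ≤ (deg w m x + deg w m y) * (1 - (g y - g x)) := by
  have hd : combDist w y x = 1 := by rw [hG.dist_comm, hG.dist_eq_one hxy]
  have hle := hg.le_add_one hG hxy
  set g' : V → ℝ := fun z => max (g z) (g x + 1 - combDist w y z) with hg'
  have hg'x : g' x = g x := by simp [hg', hd]
  have hg'y : g' y = g x + 1 := by simp [hg', hG.dist_self, hle]
  have hlap := lap_le_lap_of_adj hG hN (hg.sup (lip1_const_sub_dist hG (g x + 1) y)) hxy
    (show g' y - g' x = 1 by rw [hg'x, hg'y]; ring)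
  change lap w m g' y ≤ lap w m g' x at hlap
  have hge : ∀ z, g z ≤ g' z := fun z => le_max_left _ _
  have hub : ∀ z, g' z ≤ g z + (1 - (g y - g x)) := fun z =>
    max_le (by linarith) (by have := hg z y; rw [hG.dist_comm] at this; linarith)
  have hx := lap_le_deg_mul hG (h := fun z => g' z - g z) (x := x) (c := 1 - (g y - g x))
    (fun z _ => by linarith [hub z])
  have hy := lap_le_deg_mul hG (h := fun z => g z - g' z) (x := y) (c := 1 - (g y - g x))
    (fun z _ => by linarith [hge z])
  rw [lap_sub hG] at hx hy
  linarith

/-- Nonnegative curvature between arbitrary vertices, in the form saying that short heat flow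
preserves the Lipschitz bound between `x` and `y`. -/
theorem exists_lap_sub_le (hG : IsGraphBase w m (combDist w))
    (hN : NonnegCurv w m (combDist w)) (x y : V) :
    ∃ C : ℝ, 0 ≤ C ∧ ∀ g : V → ℝ, Lip1 (combDist w) g →
      lap w m g y - lap w m g x ≤ C * (combDist w x y - (g y - g x)) := by
  obtain ⟨n, hn⟩ := hG.exists_dist_eq_nat x y
  induction n generalizing x with
  | zero =>
    have hxy : x = y := by
      by_contra h
      have := hG.dist_pos h
      simp [hn] at this
    subst hxy
    exact ⟨0, le_rfl, fun g _ => by simp⟩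
  | succ n ih =>
    have hne : x ≠ y := by
      rintro rfl
      rw [hG.dist_self] at hn
      exact (Nat.cast_add_one_ne_zero (R := ℝ) n) (by exact_mod_cast hn.symm)
    obtain ⟨z, hz, hd⟩ := hG.exists_step hne
    obtain ⟨C, hC, h⟩ := ih z (by rw [hd, hn]; push_cast; ring)
    refine ⟨max C (deg w m x + deg w m z), le_max_of_le_left hC, fun g hg => ?_⟩
    have h1 := h g hg
    have h2 := lap_sub_le_of_adj hG hN hz hg
    have h3 := mul_le_mul_of_nonneg_right (le_max_left C (deg w m x + deg w m z))
      (sub_nonneg.2 (hg z y))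
    have h4 := mul_le_mul_of_nonneg_right (le_max_right C (deg w m x + deg w m z))
      (sub_nonneg.2 (sub_le_iff_le_add'.2 (hg.le_add_one hG hz)))
    calc lap w m g y - lap w m g x
        ≤ max C (deg w m x + deg w m z) * (combDist w z y - (g y - g z)) +
          max C (deg w m x + deg w m z) * (1 - (g z - g x)) := by linarith
      _ = _ := by rw [hd]; ring

/-- Optimal transport along a unit gradient edge `v ∼ v'` of a harmonic function, expressed by
duality: each neighbor of `v` is joined to the unit ball around `v'` by a unit gradient path. -/
theorem exists_transport (hG : IsGraphBase w m (combDist w)) (hN : NonnegCurv w m (combDist w))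
    {f : V → ℝ} (hf : Lip1 (combDist w) f) (hΔ : ∀ x, lap w m f x = 0) {v v' u : V}
    (hv : 0 < w v v') (h1 : f v' = f v + 1) (hu : 0 < w v u) :
    ∃ z, (z = v' ∨ 0 < w v' z) ∧ f z = f u + combDist w u z := by
  classical
  by_contra! hcon
  have hlt : ∀ z ∈ insert v' (nbrs hG v'), 0 < f u + combDist w u z - f z := by
    intro z hz
    rw [Finset.mem_insert, mem_nbrs] at hz
    have := (hf u z).lt_of_ne (fun h => hcon z hz (by linarith))
    linarith
  obtain ⟨δ, hδ, hδle⟩ : ∃ δ : ℝ, 0 < δ ∧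
      ∀ z ∈ insert v' (nbrs hG v'), δ ≤ f u + combDist w u z - f z := by
    obtain ⟨z, hz, hmin⟩ := Finset.exists_min_image (insert v' (nbrs hG v'))
      (fun z => f u + combDist w u z - f z) (Finset.insert_nonempty _ _)
    exact ⟨_, hlt z hz, hmin⟩
  set g : V → ℝ := fun z => min (f z) ((f u - δ) + combDist w u z) with hg
  have hgl : Lip1 (combDist w) g := hf.inf (lip1_const_add_dist hG _ u)
  have heq : ∀ z, (z = v' ∨ 0 < w v' z) → g z = f z := by
    intro z hz
    exact min_eq_left (by
      have := hδle z (by rwa [Finset.mem_insert, mem_nbrs])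
      linarith)
  have hgv : g v = f v := heq v (Or.inr (by rwa [hG.weight_comm]))
  have hgv' : g v' = f v' := heq v' (Or.inl rfl)
  have hle := lap_le_lap_of_adj hG hN hgl hv (by rw [hgv, hgv', h1]; ring)
  have hpos := lap_pos hG (h := fun z => f z - g z) (x := v) (y := u)
    (fun z _ => by
      rw [hgv, sub_self, sub_nonneg]
      exact min_le_left _ _) hu
    (by
      have : g u ≤ f u - δ + combDist w u u := min_le_right _ _
      rw [hG.dist_self] at this
      rw [hgv]
      linarith)
  have hnn := lap_nonneg hG (h := fun z => g z - f z) (x := v')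
    (fun z hz => by rw [hgv', heq z (Or.inr hz)]; simp)
  rw [lap_sub hG, hΔ] at hpos hnn
  linarith

end Curvature

section Extension

variable {w : V → V → ℝ} {m : V → ℝ}

open Classical in
/-- The Lipschitz extension from the finite set `A` which is maximal on `Y` and minimal
elsewhere. -/
noncomputable def lipExt (w : V → V → ℝ) (A : Finset V) (hA : A.Nonempty) (Y : Set V)
    (g : V → ℝ) (v : V) : ℝ :=
  if v ∈ Y then A.inf' hA (fun u => g u + combDist w v u)
  else A.sup' hA (fun u => g u - combDist w v u)

variable {A : Finset V} {hA : A.Nonempty} {Y : Set V} {g g' : V → ℝ}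

theorem lipExt_of_mem {v : V} (hv : v ∈ Y) :
    lipExt w A hA Y g v = A.inf' hA (fun u => g u + combDist w v u) := if_pos hv

theorem lipExt_of_notMem {v : V} (hv : v ∉ Y) :
    lipExt w A hA Y g v = A.sup' hA (fun u => g u - combDist w v u) := if_neg hv

theorem lipExt_le {v u : V} (hv : v ∈ Y) (hu : u ∈ A) :
    lipExt w A hA Y g v ≤ g u + combDist w v u := by
  rw [lipExt_of_mem hv]
  exact Finset.inf'_le (fun u => g u + combDist w v u) hu

theorem le_lipExt {v u : V} (hv : v ∉ Y) (hu : u ∈ A) :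
    g u - combDist w v u ≤ lipExt w A hA Y g v := by
  rw [lipExt_of_notMem hv]
  exact Finset.le_sup' (fun u => g u - combDist w v u) hu

theorem exists_lipExt_eq_add {v : V} (hv : v ∈ Y) :
    ∃ u ∈ A, lipExt w A hA Y g v = g u + combDist w v u := by
  rw [lipExt_of_mem hv]
  exact Finset.exists_mem_eq_inf' hA _

theorem exists_lipExt_eq_sub {v : V} (hv : v ∉ Y) :
    ∃ u ∈ A, lipExt w A hA Y g v = g u - combDist w v u := by
  rw [lipExt_of_notMem hv]
  exact Finset.exists_mem_eq_sup' hA _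

theorem lipExt_mono (h : ∀ u ∈ A, g u ≤ g' u) (v : V) :
    lipExt w A hA Y g v ≤ lipExt w A hA Y g' v := by
  by_cases hv : v ∈ Y
  · obtain ⟨u, hu, he⟩ := exists_lipExt_eq_add (w := w) (hA := hA) (g := g') hv
    rw [he]
    exact (lipExt_le hv hu).trans (by linarith [h u hu])
  · obtain ⟨u, hu, he⟩ := exists_lipExt_eq_sub (w := w) (hA := hA) (g := g) hv
    rw [he]
    exact le_trans (by linarith [h u hu]) (le_lipExt hv hu)

theorem lipExt_eq_self (hG : IsGraphBase w m (combDist w)) (hdisj : ∀ u ∈ A, u ∉ Y)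
    (hg : Lip1On (combDist w) A g) {v : V} (hv : v ∈ A) : lipExt w A hA Y g v = g v := by
  apply le_antisymm
  · obtain ⟨u, hu, he⟩ := exists_lipExt_eq_sub (w := w) (hA := hA) (g := g) (hdisj v hv)
    rw [he]
    linarith [hg v hv u hu]
  · have := le_lipExt (w := w) (hA := hA) (g := g) (hdisj v hv) hv
    rwa [hG.dist_self, sub_zero] at this

theorem lipExt_lip1 (hG : IsGraphBase w m (combDist w))
    (hsep : ∀ y ∈ Y, ∀ z, z ∉ Y → z ∉ A → ¬ 0 < w y z)
    (hg : Lip1On (combDist w) A g) : Lip1 (combDist w) (lipExt w A hA Y g) := by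
  intro x y
  by_cases hx : x ∈ Y <;> by_cases hy : y ∈ Y
  · obtain ⟨u, hu, he⟩ := exists_lipExt_eq_add (w := w) (hA := hA) (g := g) hx
    have := lipExt_le (w := w) (hA := hA) (g := g) hy hu
    have := hG.dist_triangle y x u
    rw [hG.dist_comm y x] at this
    linarith
  · obtain ⟨u, hu, he⟩ := exists_lipExt_eq_add (w := w) (hA := hA) (g := g) hx
    obtain ⟨u', hu', he'⟩ := exists_lipExt_eq_sub (w := w) (hA := hA) (g := g) hy
    have := hg u hu u' hu'
    have := hG.dist_triangle u x u'
    have := hG.dist_triangle x y u'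
    rw [hG.dist_comm u x] at *
    linarith
  · obtain ⟨u, hu, he⟩ := hG.exists_between (A := A) hsep hx hy
    have := lipExt_le (w := w) (hA := hA) (g := g) hy hu
    have := le_lipExt (w := w) (hA := hA) (g := g) hx hu
    rw [hG.dist_comm x y]
    rw [hG.dist_comm x u] at *
    linarith
  · obtain ⟨u, hu, he⟩ := exists_lipExt_eq_sub (w := w) (hA := hA) (g := g) hy
    have := le_lipExt (w := w) (hA := hA) (g := g) hx hu
    have := hG.dist_triangle x y u
    linarith

end Extension

section Volume

variable {w : V → V → ℝ} {m : V → ℝ}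

theorem InfVolume.diff {Y : Set V} (hm : ∀ x, 0 < m x) (h : InfVolume m Y) (B : Finset V) :
    InfVolume m (Y \ B) := by
  classical
  intro c
  obtain ⟨F, hF, hc⟩ := h (c + ∑ x ∈ B, m x)
  refine ⟨F \ B, ?_, ?_⟩
  · rw [Finset.coe_sdiff]
    exact Set.sdiff_subset_sdiff_left hF
  · have h1 : ∑ x ∈ F, m x ≤ ∑ x ∈ (F \ B) ∪ B, m x :=
      Finset.sum_le_sum_of_subset_of_nonneg (by simp) (fun x _ _ => (hm x).le)
    rw [Finset.sum_union Finset.sdiff_disjoint] at h1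
    linarith

theorem InfVolume.nonempty {Y : Set V} (h : InfVolume m Y) : Y.Nonempty := by
  obtain ⟨F, hF, hc⟩ := h 0
  rcases F.eq_empty_or_nonempty with rfl | ⟨x, hx⟩
  · simp at hc
  · exact ⟨x, hF hx⟩

/-- Green's formula: if `g` increases along all edges leaving the finite set `F`, except those
ending in `A`, then the total Laplacian over `F` is bounded below in terms of `A` only. -/
theorem neg_le_sum_measure_mul_lap (hG : IsGraphBase w m (combDist w)) {A F : Finset V}
    {g : V → ℝ} (hg : Lip1 (combDist w) g)
    (hout : ∀ y ∈ F, ∀ z, 0 < w y z → z ∉ F → z ∉ A → g y ≤ g z) :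
    -∑ z ∈ A, ∑ y ∈ nbrs hG z, w z y ≤ ∑ y ∈ F, m y * lap w m g y := by
  classical
  set N : Finset V := F ∪ A ∪ F.biUnion (nbrs hG) with hN
  have hFN : F ⊆ N := by
    intro x hx
    simp [hN, hx]
  have hlap : ∀ y ∈ F, m y * lap w m g y = ∑ z ∈ N, w y z * (g z - g y) := by
    intro y hy
    have hsub : nbrs hG y ⊆ N := by
      intro z hz
      simp only [hN, Finset.mem_union, Finset.mem_biUnion]
      exact Or.inr ⟨y, hy, hz⟩
    rw [lap, finsum_weight_mul hG hsub, mul_inv_cancel_left₀ (hG.measure_pos y).ne']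
  have hzero : ∑ y ∈ F, ∑ z ∈ F, w y z * (g z - g y) = 0 := by
    have h1 : ∑ y ∈ F, ∑ z ∈ F, w y z * (g z - g y) =
        -∑ y ∈ F, ∑ z ∈ F, w y z * (g z - g y) := by
      conv_lhs => rw [Finset.sum_comm]
      rw [← Finset.sum_neg_distrib]
      refine Finset.sum_congr rfl fun y _ => ?_
      rw [← Finset.sum_neg_distrib]
      refine Finset.sum_congr rfl fun z _ => ?_
      rw [hG.weight_comm z y]
      ring
    linarith
  have hterm : ∀ y ∈ F, ∀ z ∈ N \ F, -(if z ∈ A then w z y else 0) ≤ w y z * (g z - g y) := by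
    intro y hy z hz
    have hzF := (Finset.mem_sdiff.1 hz).2
    rcases (hG.weight_nonneg y z).eq_or_lt with h0 | h0
    · rw [hG.weight_comm z y, ← h0]
      simp
    · split_ifs with hzA
      · have := (hg.le_add_one hG (x := z) (y := y) (by rwa [hG.weight_comm]))
        rw [hG.weight_comm z y]
        nlinarith
      · rw [neg_zero]
        exact mul_nonneg h0.le (sub_nonneg.2 (hout y hy z h0 hzF hzA))
  have hbd : ∑ y ∈ F, ∑ z ∈ N \ F, (if z ∈ A then w z y else 0) ≤
      ∑ z ∈ A, ∑ y ∈ nbrs hG z, w z y := by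
    rw [Finset.sum_comm]
    have hnn : ∀ z, 0 ≤ ∑ y ∈ F, w z y := fun z =>
      Finset.sum_nonneg fun y _ => hG.weight_nonneg z y
    calc ∑ z ∈ N \ F, ∑ y ∈ F, (if z ∈ A then w z y else 0)
        = ∑ z ∈ N \ F, (if z ∈ A then ∑ y ∈ F, w z y else 0) := by
          refine Finset.sum_congr rfl fun z _ => ?_
          split_ifs <;> simp
      _ = ∑ z ∈ (N \ F).filter (· ∈ A), ∑ y ∈ F, w z y := (Finset.sum_filter _ _).symm
      _ ≤ ∑ z ∈ A, ∑ y ∈ F, w z y :=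
          Finset.sum_le_sum_of_subset_of_nonneg (fun z hz => (Finset.mem_filter.1 hz).2)
            (fun z _ _ => hnn z)
      _ ≤ ∑ z ∈ A, ∑ y ∈ nbrs hG z, w z y := by
          refine Finset.sum_le_sum fun z _ => ?_
          have h1 : ∑ y ∈ F.filter (0 < w z ·), w z y = ∑ y ∈ F, w z y := by
            refine Finset.sum_filter_of_ne fun y _ hne => ?_
            exact (hG.weight_nonneg z y).lt_of_ne' hne
          rw [← h1]
          exact Finset.sum_le_sum_of_subset_of_nonneg
            (fun y hy => (mem_nbrs hG).2 (Finset.mem_filter.1 hy).2)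
            (fun y _ _ => hG.weight_nonneg z y)
  have hsplit : ∑ y ∈ F, m y * lap w m g y =
      ∑ y ∈ F, ∑ z ∈ N \ F, w y z * (g z - g y) := by
    rw [Finset.sum_congr rfl hlap]
    have : ∀ y ∈ F, ∑ z ∈ N, w y z * (g z - g y) =
        ∑ z ∈ N \ F, w y z * (g z - g y) + ∑ z ∈ F, w y z * (g z - g y) := fun y _ =>
      (Finset.sum_sdiff hFN).symm
    rw [Finset.sum_congr rfl this, Finset.sum_add_distrib, hzero, add_zero]
  rw [hsplit]
  have := Finset.sum_le_sum fun y hy => Finset.sum_le_sum (hterm y hy)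
  simp only [Finset.sum_neg_distrib] at this
  linarith

/-- A maximal Lipschitz extension to a region of infinite volume cannot have strictly negative
Laplacian on the finite set it is extended from. -/
theorem exists_lap_nonneg (hG : IsGraphBase w m (combDist w)) (hN : NonnegCurv w m (combDist w))
    {A : Finset V} (hA : A.Nonempty) {Y : Set V}
    (hsep : ∀ y ∈ Y, ∀ z, z ∉ Y → z ∉ A → ¬ 0 < w y z) (hvol : InfVolume m Y)
    {g : V → ℝ} (hg : Lip1 (combDist w) g) (hY : ∀ y ∈ Y, ∃ u ∈ A, g y = g u + combDist w y u) :
    ∃ u ∈ A, 0 ≤ lap w m g u := by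
  classical
  by_contra! hneg
  obtain ⟨u₀, hu₀, hmax⟩ := A.exists_max_image (lap w m g) hA
  set c := -lap w m g u₀ with hc
  have hcpos : 0 < c := neg_pos.2 (hneg u₀ hu₀)
  have hYle : ∀ y ∈ Y, lap w m g y ≤ -c := by
    intro y hy
    obtain ⟨u, hu, he⟩ := hY y hy
    obtain ⟨C, -, h⟩ := exists_lap_sub_le hG hN u y
    have h1 := h g hg
    rw [he, hG.dist_comm u y, add_sub_cancel_left, sub_self, mul_zero] at h1
    linarith [hmax u hu]
  set W := ∑ z ∈ A, ∑ y ∈ nbrs hG z, w z y with hW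
  obtain ⟨F₀, hF₀, hlt⟩ := hvol (W / c)
  obtain ⟨R, hR⟩ : ∃ R : ℝ, ∀ y ∈ F₀, g y < R :=
    ⟨∑ y ∈ F₀, |g y| + 1, fun y hy => by
      have := Finset.single_le_sum (f := fun y => |g y|) (fun y _ => abs_nonneg _) hy
      have := le_abs_self (g y)
      linarith⟩
  have hfin : {y | y ∈ Y ∧ g y < R}.Finite := by
    refine (A.finite_toSet.biUnion fun u _ => hG.finite_ball u (R - g u)).subset ?_
    rintro y ⟨hy, hyR⟩
    obtain ⟨u, hu, he⟩ := hY y hy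
    refine Set.mem_biUnion (Finset.mem_coe.2 hu) ?_
    change combDist w u y ≤ R - g u
    rw [hG.dist_comm]
    linarith
  have hgreen := neg_le_sum_measure_mul_lap hG (A := A) (F := hfin.toFinset) hg (by
    intro y hy z hyz hzF hzA
    simp only [Set.Finite.mem_toFinset, Set.mem_ofPred_eq, not_and, not_lt] at hy hzF
    by_cases hzY : z ∈ Y
    · linarith [hzF hzY]
    · exact absurd hyz (hsep y hy.1 z hzY hzA))
  have h1 : ∑ y ∈ hfin.toFinset, m y * lap w m g y ≤ ∑ y ∈ hfin.toFinset, m y * -c := by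
    refine Finset.sum_le_sum fun y hy => ?_
    simp only [Set.Finite.mem_toFinset, Set.mem_ofPred_eq] at hy
    exact mul_le_mul_of_nonneg_left (hYle y hy.1) (hG.measure_pos y).le
  have h2 : ∑ y ∈ F₀, m y ≤ ∑ y ∈ hfin.toFinset, m y :=
    Finset.sum_le_sum_of_subset_of_nonneg (fun y hy => by
      simpa using ⟨hF₀ hy, hR y hy⟩) (fun y _ _ => (hG.measure_pos y).le)
  rw [← Finset.sum_mul] at h1
  rw [div_lt_iff₀ hcpos] at hlt
  nlinarith

end Volume

section HeatFlow

variable {w : V → V → ℝ} {m : V → ℝ}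

/-- The discrete heat flow with time step `ε`, composed with the extremal Lipschitz extension. -/
noncomputable def extFlow (w : V → V → ℝ) (m : V → ℝ) (ε : ℝ) (A : Finset V) (hA : A.Nonempty)
    (Y : Set V) (f : V → ℝ) : ℕ → V → ℝ
  | 0 => f
  | n + 1 => fun x => lipExt w A hA Y (extFlow w m ε A hA Y f n) x +
      ε * lap w m (lipExt w A hA Y (extFlow w m ε A hA Y f n)) x

theorem exists_time_step (hG : IsGraphBase w m (combDist w))
    (hN : NonnegCurv w m (combDist w)) (A : Finset V) :
    ∃ ε : ℝ, 0 < ε ∧ (∀ x ∈ A, ε * deg w m x < 1) ∧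
      ∀ x ∈ A, ∀ y ∈ A, ∀ g : V → ℝ, Lip1 (combDist w) g →
        (g y + ε * lap w m g y) - (g x + ε * lap w m g x) ≤ combDist w x y := by
  choose C hC hCle using exists_lap_sub_le hG hN
  set M := 1 + ∑ x ∈ A, deg w m x + ∑ x ∈ A, ∑ y ∈ A, C x y with hM
  have h1 : 0 ≤ ∑ x ∈ A, deg w m x := Finset.sum_nonneg fun x _ => deg_nonneg hG x
  have h2 : 0 ≤ ∑ x ∈ A, ∑ y ∈ A, C x y :=
    Finset.sum_nonneg fun x _ => Finset.sum_nonneg fun y _ => hC x y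
  have hMpos : 0 < M := by linarith
  refine ⟨M⁻¹, inv_pos.2 hMpos, fun x hx => ?_, fun x hx y hy g hg => ?_⟩
  · have := Finset.single_le_sum (f := fun x => deg w m x) (fun x _ => deg_nonneg hG x) hx
    rw [inv_mul_lt_iff₀ hMpos]
    linarith
  · have h3 := Finset.single_le_sum (f := fun y => C x y) (fun y _ => hC x y) hy
    have h4 := Finset.single_le_sum (f := fun x => ∑ y ∈ A, C x y)
      (fun x _ => Finset.sum_nonneg fun y _ => hC x y) hx
    have h5 : M⁻¹ * C x y ≤ 1 := by
      rw [inv_mul_le_iff₀ hMpos]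
      linarith
    have h6 := mul_le_mul_of_nonneg_left (hCle x y g hg) (inv_pos.2 hMpos).le
    have h7 := mul_le_mul_of_nonneg_right h5 (sub_nonneg.2 (hg x y))
    nlinarith

/-- If `f` is harmonic, dominates its extremal extension and strictly so at `v`, then the flow
started at `f` decreases strictly everywhere on `A` after finitely many steps, provided the
geodesics from `A` to `v` stay inside `A`. -/
theorem extFlow_decreasing (hG : IsGraphBase w m (combDist w)) {A : Finset V}
    (hA : A.Nonempty) {Y : Set V} (hdisj : ∀ u ∈ A, u ∉ Y)
    (hsep : ∀ y ∈ Y, ∀ z, z ∉ Y → z ∉ A → ¬ 0 < w y z)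
    {ε : ℝ} (hε : 0 < ε) (hd : ∀ x ∈ A, ε * deg w m x < 1)
    (hlip : ∀ x ∈ A, ∀ y ∈ A, ∀ g : V → ℝ, Lip1 (combDist w) g →
      (g y + ε * lap w m g y) - (g x + ε * lap w m g x) ≤ combDist w x y)
    {f : V → ℝ} (hf : Lip1 (combDist w) f) (hΔ : ∀ x, lap w m f x = 0)
    (hle : ∀ x, lipExt w A hA Y f x ≤ f x) {v : V} (hvA : v ∉ A)
    (hlt : lipExt w A hA Y f v < f v)
    (hball : ∀ x ∈ A, ∀ z, z ≠ v → combDist w z v ≤ combDist w x v → z ∈ A) (n : ℕ) :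
    Lip1On (combDist w) A (extFlow w m ε A hA Y f n) ∧
      ∀ x ∈ A, extFlow w m ε A hA Y f (n + 1) x ≤ extFlow w m ε A hA Y f n x ∧
        (combDist w x v ≤ n + 1 →
          extFlow w m ε A hA Y f (n + 1) x < extFlow w m ε A hA Y f n x) := by
  induction n with
  | zero =>
    have hfA : Lip1On (combDist w) A f := fun x _ y _ => hf x y
    refine ⟨hfA, fun x hx => ?_⟩
    have hself : lipExt w A hA Y f x = f x := lipExt_eq_self hG hdisj hfA hx
    have hlapeq := lap_sub hG f (lipExt w A hA Y f) x
    rw [hΔ, zero_sub] at hlapeq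
    have hnn : ∀ z, 0 < w x z → f x - lipExt w A hA Y f x ≤ f z - lipExt w A hA Y f z := by
      intro z _
      rw [hself, sub_self, sub_nonneg]
      exact hle z
    simp only [extFlow, hself]
    constructor
    · have := lap_nonneg hG (h := fun z => f z - lipExt w A hA Y f z) hnn
      rw [hlapeq] at this
      nlinarith
    · intro hxv
      have hne : x ≠ v := fun h => hvA (h ▸ hx)
      obtain ⟨z, hz, hdz⟩ := hG.exists_step hne
      have hzv : z = v := by
        by_contra h
        have := hG.dist_pos h
        simp at hxv
        linarith
      subst hzv
      have := lap_pos hG (h := fun z => f z - lipExt w A hA Y f z) hnn hz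
        (by rw [hself, sub_self, sub_pos]; exact hlt)
      rw [hlapeq] at this
      nlinarith
  | succ n ih =>
    obtain ⟨ihL, ih⟩ := ih
    have hext := lipExt_lip1 (hA := hA) hG hsep ihL
    have hL : Lip1On (combDist w) A (extFlow w m ε A hA Y f (n + 1)) := fun x hx y hy =>
      hlip x hx y hy _ hext
    refine ⟨hL, fun x hx => ?_⟩
    set G := extFlow w m ε A hA Y f n with hGdef
    set G' := extFlow w m ε A hA Y f (n + 1) with hG'def
    set h : V → ℝ := fun z => lipExt w A hA Y G z - lipExt w A hA Y G' z with hh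
    have hnn : ∀ z, 0 ≤ h z := fun z => sub_nonneg.2 (lipExt_mono (fun u hu => (ih u hu).1) z)
    have hself : ∀ z ∈ A, h z = G z - G' z := fun z hz => by
      rw [hh]
      simp only
      rw [lipExt_eq_self hG hdisj ihL hz, lipExt_eq_self hG hdisj hL hz]
    have hdiff : G' x - extFlow w m ε A hA Y f (n + 1 + 1) x = h x + ε * lap w m h x := by
      rw [hh, lap_sub hG]
      simp only
      rw [hG'def]
      conv_lhs => rw [extFlow, extFlow]
      rw [← hGdef]
      change _ - (lipExt w A hA Y G' x + ε * lap w m (lipExt w A hA Y G') x) = _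
      ring
    constructor
    · have := add_mul_lap_nonneg hG hnn hε (hd x hx)
      linarith
    · intro hxv
      suffices 0 < h x + ε * lap w m h x by linarith
      have hne : x ≠ v := fun h => hvA (h ▸ hx)
      obtain ⟨z, hz, hdz⟩ := hG.exists_step hne
      by_cases hzv : z = v
      · refine add_mul_lap_pos_of_self hG hnn hε (hd x hx) ?_
        rw [hself x hx, sub_pos]
        refine (ih x hx).2 ?_
        subst hzv
        rw [hG.dist_eq_one hz]
        have : (0 : ℝ) ≤ n := Nat.cast_nonneg n
        linarith
      · have hzA : z ∈ A := hball x hx z hzv (by linarith)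
        refine add_mul_lap_pos_of_adj hG hnn hε (hd x hx) hz ?_
        rw [hself z hzA, sub_pos]
        refine (ih z hzA).2 ?_
        push_cast at hxv
        linarith

/-- A Lipschitz harmonic function which is a maximal Lipschitz extension on a set of infinite
volume with finite boundary has an ascending unit gradient edge at every vertex. -/
theorem exists_ascending_edge (hG : IsGraphBase w m (combDist w))
    (hN : NonnegCurv w m (combDist w)) {Y K : Set V} (hK : K.Finite)
    (hsep : ∀ y ∈ Y, ∀ z, z ∉ Y → z ∉ K → ¬ 0 < w y z) (hvol : InfVolume m Y) {f : V → ℝ}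
    (hf : Lip1 (combDist w) f) (hΔ : ∀ x, lap w m f x = 0)
    (hY : ∀ y ∈ Y, ∃ u ∈ K, f y = f u + combDist w y u) (v : V) :
    ∃ v', 0 < w v v' ∧ f v' = f v + 1 := by
  classical
  by_contra! hcon
  obtain ⟨R, hR1, hRK⟩ : ∃ R : ℕ, 1 ≤ R ∧ ∀ u ∈ K, combDist w u v ≤ R := by
    obtain ⟨r, hr⟩ := (hK.image (combDist w · v)).bddAbove
    obtain ⟨R, hR⟩ := exists_nat_ge r
    exact ⟨R + 1, by omega, fun u hu => by
      have := hr (Set.mem_image_of_mem _ hu)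
      push_cast
      linarith⟩
  have hR1' : (1 : ℝ) ≤ R := by exact_mod_cast hR1
  have hfinB : {y | combDist w y v ≤ R}.Finite := by
    simpa only [hG.dist_comm v] using hG.finite_ball v R
  set B := hfinB.toFinset with hB
  have memB : ∀ x, x ∈ B ↔ combDist w x v ≤ R := fun x => by simp [hB]
  have hvB : v ∈ B := by
    rw [memB, hG.dist_self]
    linarith
  have hnbr : ∀ z, 0 < w v z → z ∈ B.erase v := fun z hz =>
    Finset.mem_erase.2 ⟨(hG.ne_of_adj hz).symm, (memB z).2 (by
      rw [hG.dist_comm, hG.dist_eq_one hz]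
      exact hR1')⟩
  set A := B.erase v with hAdef
  have hKA : ∀ u ∈ K, u ≠ v → u ∈ A := fun u hu hne =>
    Finset.mem_erase.2 ⟨hne, (memB u).2 (hRK u hu)⟩
  have hvol' := hvol.diff hG.measure_pos B
  have hA : A.Nonempty := by
    obtain ⟨y, hy, hyB⟩ := hvol'.nonempty
    have hne : v ≠ y := fun h => hyB (h ▸ hvB)
    obtain ⟨z, hz, -⟩ := hG.exists_step hne
    exact ⟨z, hnbr z hz⟩
  have hvA : v ∉ A := Finset.notMem_erase v B
  have hdisj : ∀ u ∈ A, u ∉ Y \ (B : Set V) := fun u hu h => h.2 (Finset.mem_of_mem_erase hu)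
  have hsep' : ∀ y ∈ Y \ (B : Set V), ∀ z, z ∉ Y \ (B : Set V) → z ∉ A → ¬ 0 < w y z := by
    rintro y ⟨hyY, hyB⟩ z hzY hzA hyz
    have hzv : z ≠ v := by
      rintro rfl
      rw [hG.weight_comm] at hyz
      exact hyB (Finset.mem_of_mem_erase (hnbr y hyz))
    have hzB : z ∉ B := fun h => hzA (Finset.mem_erase.2 ⟨hzv, h⟩)
    exact hsep y hyY z (fun h => hzY ⟨h, hzB⟩) (fun h => hzB ((memB z).2 (hRK z h))) hyz
  have hle : ∀ x, lipExt w A hA (Y \ B) f x ≤ f x := by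
    intro x
    by_cases hx : x ∈ Y \ (B : Set V)
    · obtain ⟨u, hu, he⟩ := hY x hx.1
      by_cases huv : u = v
      · subst huv
        have hne : u ≠ x := fun h => hx.2 (h ▸ hvB)
        obtain ⟨z, hz, hdz⟩ := hG.exists_step hne
        have h1 := lipExt_le (w := w) (hA := hA) (g := f) hx (hnbr z hz)
        have h2 := hf.le_add_one hG hz
        rw [hG.dist_comm x] at h1 he
        linarith
      · rw [he]
        exact lipExt_le hx (hKA u hu huv)
    · obtain ⟨u, -, he⟩ := exists_lipExt_eq_sub (w := w) (hA := hA) (g := f) hx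
      rw [he]
      linarith [hf x u]
  have hvY : v ∉ Y \ (B : Set V) := fun h => h.2 hvB
  have hlt : lipExt w A hA (Y \ B) f v < f v := by
    obtain ⟨u, hu, he⟩ := exists_lipExt_eq_sub (w := w) (hA := hA) (g := f) hvY
    rw [he]
    have hne : v ≠ u := fun h => hvA (h ▸ hu)
    obtain ⟨z, hz, hdz⟩ := hG.exists_step hne
    have h1 := (hf.le_add_one hG hz).lt_of_ne (hcon z hz)
    have h2 := hf z u
    linarith
  have hball : ∀ x ∈ A, ∀ z, z ≠ v → combDist w z v ≤ combDist w x v → z ∈ A := by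
    intro x hx z hzv hzx
    have := (memB x).1 (Finset.mem_of_mem_erase hx)
    exact Finset.mem_erase.2 ⟨hzv, (memB z).2 (hzx.trans this)⟩
  obtain ⟨ε, hε, hd, hlip⟩ := exists_time_step hG hN A
  obtain ⟨hL, hdec⟩ := extFlow_decreasing hG hA hdisj hsep' hε hd hlip hf hΔ hle hvA hlt hball R
  set g := extFlow w m ε A hA (Y \ B) f R with hg
  obtain ⟨u, hu, hpos⟩ := exists_lap_nonneg hG hN hA hsep' hvol'
    (lipExt_lip1 (hA := hA) hG hsep' hL) (fun y hy => by
      obtain ⟨u, hu, he⟩ := exists_lipExt_eq_add (w := w) (hA := hA) (g := g) hy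
      exact ⟨u, hu, by rw [he, lipExt_eq_self hG hdisj hL hu]⟩)
  have h1 := (hdec u hu).2 (by
    have := (memB u).1 (Finset.mem_of_mem_erase hu)
    linarith)
  rw [extFlow, ← hg] at h1
  simp only [lipExt_eq_self hG hdisj hL hu] at h1
  nlinarith

end HeatFlow

section Connectivity

variable {w : V → V → ℝ} {m : V → ℝ}

theorem reachIn.symm (hG : IsGraphBase w m (combDist w)) {S : Set V} {x y : V}
    (h : reachIn w S x y) : reachIn w S y x := by
  induction h with
  | refl => exact Relation.ReflTransGen.refl
  | tail _ hbc ih =>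
    exact Relation.ReflTransGen.head ⟨hbc.2.1, hbc.1, by rw [hG.weight_comm]; exact hbc.2.2⟩ ih

/-- A vertex whose neighbors are mutually connected without it can be removed from a set. -/
theorem reachIn.diff_singleton {S : Set V} {v : V}
    (hv : ∀ u₁ ∈ S \ {v}, ∀ u₂ ∈ S \ {v}, 0 < w u₁ v → 0 < w v u₂ →
      reachIn w (S \ {v}) u₁ u₂) (hvv : w v v = 0)
    {x y : V} (hx : x ∈ S \ {v}) (hy : y ∈ S \ {v}) (h : reachIn w S x y) :
    reachIn w (S \ {v}) x y := by
  suffices (y ≠ v → reachIn w (S \ {v}) x y) ∧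
      (y = v → ∃ u ∈ S \ {v}, 0 < w u v ∧ reachIn w (S \ {v}) x u) from this.1 hy.2
  clear hy
  induction h with
  | refl => exact ⟨fun _ => Relation.ReflTransGen.refl, fun h => absurd h hx.2⟩
  | @tail b c _ hbc ih =>
    obtain ⟨hb, hc, hw⟩ := hbc
    constructor
    · intro hcv
      by_cases hbv : b = v
      · obtain ⟨u, hu, huv, hr⟩ := ih.2 hbv
        subst hbv
        exact hr.trans (hv u hu c ⟨hc, hcv⟩ huv hw)
      · exact (ih.1 hbv).tail ⟨⟨hb, hbv⟩, ⟨hc, hcv⟩, hw⟩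
    · rintro rfl
      have hbv : b ≠ c := by
        rintro rfl
        exact hw.ne' hvv
      exact ⟨b, ⟨hb, hbv⟩, hw, ih.1 hbv⟩

theorem reachIn_of_unit_gradient (hG : IsGraphBase w m (combDist w)) {f : V → ℝ}
    (hf : Lip1 (combDist w) f) {S : Set V} {u z : V} (hu : u ∈ S)
    (hS : ∀ x, f u < f x → f x ≤ f z → x ∈ S) (he : f z = f u + combDist w u z) :
    reachIn w S u z := by
  obtain ⟨n, hn⟩ := hG.exists_dist_eq_nat u z
  induction n generalizing u with
  | zero =>
    have huz : u = z := by
      by_contra h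
      have := hG.dist_pos h
      simp [hn] at this
    exact huz ▸ Relation.ReflTransGen.refl
  | succ n ih =>
    have hne : u ≠ z := by
      rintro rfl
      rw [hG.dist_self] at hn
      exact (Nat.cast_add_one_ne_zero (R := ℝ) n) (by exact_mod_cast hn.symm)
    obtain ⟨x, hx, hd⟩ := hG.exists_step hne
    have h1 := hf.le_add_one hG hx
    have h2 := hf x z
    have h3 : 0 ≤ combDist w x z := hG.dist_nonneg x z
    have hxS : x ∈ S := hS x (by linarith) (by linarith)
    refine Relation.ReflTransGen.head ⟨hu, hxS, hx⟩ (ih hxS ?_ (by linarith) ?_)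
    · exact fun y hy hyz => hS y (by linarith) hyz
    · rw [hd, hn]
      push_cast
      ring

theorem reachIn_diff_singleton_of_adj (hG : IsGraphBase w m (combDist w))
    (hN : NonnegCurv w m (combDist w)) {f : V → ℝ} (hf : Lip1 (combDist w) f)
    (hΔ : ∀ x, lap w m f x = 0) {S : Set V} {v v' : V} (hv' : 0 < w v v')
    (h1 : f v' = f v + 1) (hS : ∀ z, f v < f z → f z ≤ f v + 2 → z ∈ S)
    (hmin : ∀ z ∈ S, f v ≤ f z) {u : V} (hu : u ∈ S \ {v}) (hvu : 0 < w v u) :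
    reachIn w (S \ {v}) u v' := by
  have hS' : ∀ z, f v < f z → f z ≤ f v + 2 → z ∈ S \ {v} := fun z hz hz2 =>
    ⟨hS z hz hz2, fun h => hz.ne (congrArg f h).symm⟩
  obtain ⟨z, hz, he⟩ := exists_transport hG hN hf hΔ hv' h1 hvu
  have hfu := hmin u hu.1
  have hz2 : f z ≤ f v + 2 := by
    rcases hz with rfl | hz
    · linarith
    · linarith [hf.le_add_one hG hz]
  have hv'S := hS' v' (by linarith) (by linarith)
  have hr : reachIn w (S \ {v}) u z :=
    reachIn_of_unit_gradient hG hf hu (fun x hx hxz => hS' x (by linarith) (by linarith)) he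
  rcases hz with rfl | hz
  · exact hr
  · have hzS : z ∈ S \ {v} := by
      rcases hr.cases_tail with h | ⟨_, _, h⟩
      · exact h ▸ hu
      · exact h.2.1
    exact hr.tail ⟨hzS, hv'S, by rwa [hG.weight_comm]⟩

/-- Paths can be pushed upwards along the gradient of `f` into `T`, by removing the vertices of
the finite set `S` outside `T` one at a time, in increasing order of `f`. -/
theorem reachIn_of_push_up (hG : IsGraphBase w m (combDist w)) (hN : NonnegCurv w m (combDist w))
    {f : V → ℝ} (hf : Lip1 (combDist w) f) (hΔ : ∀ x, lap w m f x = 0)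
    (hup : ∀ v, ∃ v', 0 < w v v' ∧ f v' = f v + 1) {Q T : Set V}
    (hT : ∀ x ∈ T, ∀ z ∈ Q, f x < f z → z ∈ T)
    (hQ : ∀ v ∈ Q, v ∉ T → ∀ z, f v < f z → f z ≤ f v + 2 → z ∈ Q)
    {S : Set V} (hfin : S.Finite) (hTS : T ⊆ S) (hSQ : S ⊆ Q)
    (hS : ∀ x ∈ S, ∀ z ∈ Q, f x < f z → z ∈ S) {x y : V} (hx : x ∈ T) (hy : y ∈ T)
    (h : reachIn w S x y) : reachIn w T x y := by
  induction hn : S.ncard generalizing S with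
  | zero =>
    rw [Set.ncard_eq_zero hfin] at hn
    exact absurd (hTS hx) (by simp [hn])
  | succ n ih =>
    by_cases hST : S ⊆ T
    · rwa [subset_antisymm hTS hST]
    obtain ⟨v₀, hv₀, hv₀T⟩ := Set.not_subset.1 hST
    obtain ⟨v, ⟨hv, hvT⟩, hmin'⟩ :=
      Set.exists_min_image (S \ T) f (hfin.subset Set.sdiff_subset) ⟨v₀, hv₀, hv₀T⟩
    have hmin : ∀ z ∈ S, f v ≤ f z := by
      intro z hz
      by_cases hzT : z ∈ T
      · by_contra! hlt
        exact hvT (hT z hzT v (hSQ hv) hlt)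
      · exact hmin' z ⟨hz, hzT⟩
    have hTS' : T ⊆ S \ {v} := fun z hz => ⟨hTS hz, fun h => hvT (h ▸ hz)⟩
    obtain ⟨v', hv', h1⟩ := hup v
    have hSv : ∀ z, f v < f z → f z ≤ f v + 2 → z ∈ S := fun z hz hz2 =>
      hS v hv z (hQ v (hSQ hv) hvT z hz hz2) hz
    have key : ∀ u ∈ S \ {v}, 0 < w v u → reachIn w (S \ {v}) u v' := fun u hu hvu =>
      reachIn_diff_singleton_of_adj hG hN hf hΔ hv' h1 hSv hmin hu hvu
    refine ih (hfin.subset Set.sdiff_subset) hTS' (Set.sdiff_subset.trans hSQ) ?_ ?_ ?_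
    · exact fun x hx z hz hxz =>
        ⟨hS x hx.1 z hz hxz, fun h => ((hmin x hx.1).trans_lt hxz).ne (congrArg f h).symm⟩
    · refine reachIn.diff_singleton ?_ (hG.weight_self v) (hTS' hx) (hTS' hy) h
      intro u₁ hu₁ u₂ hu₂ hw₁ hw₂
      rw [hG.weight_comm] at hw₁
      exact (key u₁ hu₁ hw₁).trans ((key u₂ hu₂ hw₂).symm hG)
    · rw [Set.ncard_sdiff_singleton_of_mem hv, hn, Nat.add_sub_cancel]

theorem exists_bounded_reachIn (hc : GraphConnected w) (f : V → ℝ) (x y : V) :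
    ∃ M : ℝ, ∀ s t, s ≤ -M → M ≤ t → reachIn w {z | s ≤ f z ∧ f z ≤ t} x y := by
  induction hc x y with
  | refl => exact ⟨0, fun _ _ _ _ => Relation.ReflTransGen.refl⟩
  | @tail b c _ hbc ih =>
    obtain ⟨M, hM⟩ := ih
    refine ⟨max M (max |f b| |f c|), fun s t hs ht => ?_⟩
    have h1 := le_max_left M (max |f b| |f c|)
    have h2 := (le_max_left |f b| |f c|).trans (le_max_right M _)
    have h3 := (le_max_right |f b| |f c|).trans (le_max_right M _)
    have hb := abs_le.1 h2
    have hc := abs_le.1 h3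
    exact (hM s t (by linarith) (by linarith)).tail
      ⟨⟨by linarith, by linarith⟩, ⟨by linarith, by linarith⟩, hbc⟩

theorem finite_setOf_le_and_le (hG : IsGraphBase w m (combDist w)) {X Y K : Set V}
    (hK : K.Finite) (hcov : X ∪ Y ∪ K = Set.univ) {f : V → ℝ}
    (hX : ∀ x ∈ X, ∃ u ∈ K, f x = f u - combDist w x u)
    (hY : ∀ y ∈ Y, ∃ u ∈ K, f y = f u + combDist w y u) (s t : ℝ) :
    {z | s ≤ f z ∧ f z ≤ t}.Finite := by
  refine (hK.biUnion fun u _ =>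
    hG.finite_ball u (max 0 (max (f u - s) (t - f u)))).subset ?_
  rintro z ⟨hs, ht⟩
  simp only [Set.mem_iUnion, Set.mem_ofPred_eq, exists_prop]
  rcases (hcov.symm ▸ Set.mem_univ z : z ∈ X ∪ Y ∪ K) with (hz | hz) | hz
  · obtain ⟨u, hu, he⟩ := hX z hz
    refine ⟨u, hu, le_max_of_le_right (le_max_of_le_left ?_)⟩
    rw [hG.dist_comm]
    linarith
  · obtain ⟨u, hu, he⟩ := hY z hz
    refine ⟨u, hu, le_max_of_le_right (le_max_of_le_right ?_)⟩
    rw [hG.dist_comm]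
    linarith
  · exact ⟨z, hz, le_max_of_le_left (hG.dist_self z).le⟩

end Connectivity

section Salami

variable {w : V → V → ℝ} {m : V → ℝ} {X Y K : Set V}

theorem SalamiPartition.not_adj (hG : IsGraphBase w m (combDist w))
    (hP : SalamiPartition w m X Y K) :
    ∀ y ∈ Y, ∀ z, z ∉ Y → z ∉ K → ¬ 0 < w y z := by
  obtain ⟨hcov, -, -, -, -, hw, -⟩ := hP
  intro y hy z hzY hzK
  have hz : z ∈ X := by
    rcases (hcov.symm ▸ Set.mem_univ z : z ∈ X ∪ Y ∪ K) with (h | h) | h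
    exacts [h, absurd h hzY, absurd h hzK]
  rw [hG.weight_comm, hw z hz y hy]
  exact lt_irrefl 0

theorem SalamiPartition.separator_nonempty (hG : IsGraphBase w m (combDist w))
    (hP : SalamiPartition w m X Y K) : K.Nonempty := by
  have hsep := hP.not_adj hG
  obtain ⟨-, hXY, -, -, -, -, hX, hY⟩ := hP
  obtain ⟨x, hx⟩ := hX.nonempty
  obtain ⟨y, hy⟩ := hY.nonempty
  obtain ⟨u, hu, -⟩ := hG.exists_between hsep (Set.disjoint_left.1 hXY hx) hy
  exact ⟨u, hu⟩

/-- On a salami partition, the operator `Sop` agrees with `lipExt`. -/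
theorem Sop_eq_lipExt (hG : IsGraphBase w m (combDist w)) (hP : SalamiPartition w m X Y K)
    {A : Finset V} (hA : A.Nonempty) (hAK : (A : Set V) = K) {f : V → ℝ}
    (hf : Lip1On (combDist w) K f) : Sop (combDist w) X Y K f = lipExt w A hA Y f := by
  obtain ⟨hcov, hXY, hXK, hYK, -⟩ := hP
  subst hAK
  funext v
  rcases (hcov.symm ▸ Set.mem_univ v : v ∈ X ∪ Y ∪ (A : Set V)) with (hv | hv) | hv
  · rw [Sop, if_neg (Set.disjoint_left.1 hXK hv), if_pos hv,
      lipExt_of_notMem (Set.disjoint_left.1 hXY hv), Finset.sup'_eq_csSup_image]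
    congr 1
    ext c
    simp [eq_comm]
  · rw [Sop, if_neg (Set.disjoint_left.1 hYK hv), if_neg (Set.disjoint_right.1 hXY hv),
      lipExt_of_mem hv, Finset.inf'_eq_csInf_image]
    congr 1
    ext c
    simp [eq_comm]
  · rw [Sop, if_pos hv, lipExt_eq_self hG (fun u hu => Set.disjoint_right.1 hYK hu) hf hv]

theorem SalamiPartition.symm (hG : IsGraphBase w m (combDist w))
    (hP : SalamiPartition w m X Y K) : SalamiPartition w m Y X K := by
  obtain ⟨hcov, hXY, hXK, hYK, hK, hw, hX, hY⟩ := hP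
  exact ⟨by rw [Set.union_comm Y X, hcov], hXY.symm, hYK, hXK, hK,
    fun y hy x hx => by rw [hG.weight_comm, hw x hx y hy], hY, hX⟩

theorem calF_properties (hG : IsGraphBase w m (combDist w)) (hP : SalamiPartition w m X Y K)
    {g : V → ℝ} (hg : g ∈ calF (combDist w) X Y K) :
    Lip1 (combDist w) g ∧ (∀ x ∈ X, ∃ u ∈ K, g x = g u - combDist w x u) ∧
      ∀ y ∈ Y, ∃ u ∈ K, g y = g u + combDist w y u := by
  obtain ⟨f, hf, rfl⟩ := hg
  have hKfin := hP.2.2.2.2.1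
  have hAK : (hKfin.toFinset : Set V) = K := hKfin.coe_toFinset
  have hA : hKfin.toFinset.Nonempty := by
    simpa using hP.separator_nonempty hG
  have hmem : ∀ u, u ∈ hKfin.toFinset ↔ u ∈ K := fun u => by simp
  rw [Sop_eq_lipExt hG hP hA hAK hf]
  have hfA : Lip1On (combDist w) hKfin.toFinset f := by rwa [hAK]
  have hself : ∀ u ∈ hKfin.toFinset, lipExt w _ hA Y f u = f u := fun u hu =>
    lipExt_eq_self hG (fun z hz => Set.disjoint_right.1 hP.2.2.2.1 ((hmem z).1 hz)) hfA hu
  refine ⟨lipExt_lip1 hG ?_ hfA, fun x hx => ?_, fun y hy => ?_⟩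
  · simpa only [hmem] using hP.not_adj hG
  · obtain ⟨u, hu, he⟩ := exists_lipExt_eq_sub (w := w) (hA := hA) (g := f)
      (Set.disjoint_left.1 hP.2.1 hx)
    exact ⟨u, (hmem u).1 hu, by rw [he, hself u hu]⟩
  · obtain ⟨u, hu, he⟩ := exists_lipExt_eq_add (w := w) (hA := hA) (g := f) hy
    exact ⟨u, (hmem u).1 hu, by rw [he, hself u hu]⟩

end Salami

/-- **Lemma (Connected level sets).** On a salami with combinatorial distance
and connected salami partition `P`, for `f ∈ ℋ(P)` and `b - a ≥ 2` the level
set `f⁻¹([a,b))` is connected as an induced subgraph. -/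
theorem level_sets_connected {V : Type*} (w : V → V → ℝ) (m : V → ℝ)
    (hS : IsSalami w m (combDist w)) (X Y K : Set V)
    (hP : ConnectedSalamiPartition w m X Y K)
    (f : V → ℝ) (hf : f ∈ calH w m (combDist w) X Y K)
    (a b : ℝ) (hab : 2 ≤ b - a) :
    ConnectedIn w {x | a ≤ f x ∧ f x < b} := by
  obtain ⟨hG, hN, -⟩ := hS
  obtain ⟨hP, -⟩ := hP
  obtain ⟨hfF, hΔ⟩ := hf
  obtain ⟨hLip, hX, hY⟩ := calF_properties hG hP hfF
  have hK : K.Finite := hP.2.2.2.2.1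
  have hup := exists_ascending_edge hG hN hK (hP.not_adj hG) hP.2.2.2.2.2.2.2 hLip hΔ hY
  have hLip' := hLip.neg hG
  have hΔ' : ∀ x, lap w m (fun z => -f z) x = 0 := fun x => by rw [lap_neg hG, hΔ, neg_zero]
  have hdown := exists_ascending_edge hG hN hK ((hP.symm hG).not_adj hG) hP.2.2.2.2.2.2.1
    hLip' hΔ' (fun x hx => by
      obtain ⟨u, hu, he⟩ := hX x hx
      exact ⟨u, hu, by rw [he]; ring⟩)
  intro x hx y hy
  obtain ⟨M, hM⟩ := exists_bounded_reachIn hG.connected f x y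
  set s := min a (-M)
  set t := max b M
  have hsa : s ≤ a := min_le_left _ _
  have hbt : b ≤ t := le_max_left _ _
  have hfin := finite_setOf_le_and_le hG hK hP.1 hX hY s t
  have hreach := hM s t (min_le_right _ _) (le_max_right _ _)
  have hstep : reachIn w {z | s ≤ f z ∧ f z < b} x y := by
    refine reachIn_of_push_up hG hN hLip' hΔ' hdown (Q := {z | s ≤ f z}) ?_ ?_ hfin ?_ ?_ ?_
      ⟨hsa.trans hx.1, hx.2⟩ ⟨hsa.trans hy.1, hy.2⟩ hreach
    · exact fun u hu z hz huz => ⟨hz, by linarith [hu.2]⟩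
    · intro v hv hvT z _ hz2
      have hvb : b ≤ f v := not_lt.1 fun h => hvT ⟨hv, h⟩
      change s ≤ f z
      linarith
    · exact fun z hz => ⟨hz.1, hz.2.le.trans hbt⟩
    · exact fun z hz => hz.1
    · exact fun u hu z hz huz => ⟨hz, by linarith [hu.2]⟩
  refine reachIn_of_push_up hG hN hLip hΔ hup (Q := {z | f z < b}) ?_ ?_
    (hfin.subset fun z hz => ⟨hz.1, hz.2.le.trans hbt⟩) ?_ ?_ ?_ hx hy hstep
  · exact fun u hu z hz huz => ⟨hu.1.trans huz.le, hz⟩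
  · intro v hv hvT z _ hz2
    have hva : f v < a := not_le.1 fun h => hvT ⟨h, hv⟩
    change f z < b
    linarith
  · exact fun z hz => ⟨hsa.trans hz.1, hz.2⟩
  · exact fun z hz => hz.2
  · exact fun u hu z hz huz => ⟨hu.1.trans huz.le, hz⟩


end SalamiPaper
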